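/- Let m ≥ 1 and a, b_1,…,b_m, c_1,…,c_m ∈ ℂ with a ≠ 0, β_{0,i} = b_i ≠ 0, β_{1,i} = c_i − 1 − b_i ≠ 0 for all i, and γ_w = a − Σ_i w_i c_i + |w| ≠ 0 for all w ∈ {0,1}^m. Let C, (e_v), f_v, Σβ_v, Πβ_v be as follows: C_{v,v'} = Σ_{w∈{0,1}^m} A_w ∏_{i: w_i=0} δ(v_i,v'_i)/β_{v_i,i} (A_w the chain sum, A_{(0,…,0)} = 1); (e_v) the standard row-vector basis of ℂ^{2^m}; Σβ_v = Σ_i β_{v_i,i}; Πβ_v = ∏_i β_{v_i,i}; f_v = ((a − Σβ_v)/a) e_v − Σ_{j=1}^m (β_{1−v_j,j}/a) e_{σ_j·v} with σ_j·v being v with the j-th coordinate flipped. Fix v ∈ {0,1}^m and let N_v be the 2^m × 2^m matrix with entries (N_v)_{u,w} = −a·Πβ_v·(C·f_vᵀ)_u·(f_v)_w, acting on row vectors by z ↦ z·N_v. Then: (1) f_v·N_v = (Σβ_v − a)·f_v; (2) e_w·N_v = 0 for every w ≠ v; (3) if Σβ_v ≠ a, the kernel of z ↦ z·N_v is the span of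 {e_w : w ≠ v} and has dimension 2^m − 1, the eigenspace of the eigenvalue Σβ_v − a is spanned by f_v, and 0 and Σβ_v − a are the only eigenvalues of N_v. -/

import Mathlib

open Finset
open scoped Classical

/-- `v_i ∈ {0,1}` regarded as a complex number. -/
noncomputable def bval (s : Bool) : ℂ := if s then 1 else 0

/-- The parameters `β_{0,i} = b_i`, `β_{1,i} = c_i − 1 − b_i`. -/
noncomputable def betaP {m : ℕ} (b c : Fin m → ℂ) (s : Bool) (i : Fin m) : ℂ :=
  if s then c i - 1 - b i else b i

/-- `σ_k·v` : flip the `k`-th coordinate of `v`. -/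
def flipv {m : ℕ} (k : Fin m) (v : Fin m → Bool) : Fin m → Bool :=
  Function.update v k (!(v k))

/-- The weight `|v| = Σ v_i` of `v ∈ {0,1}^m`. -/
def wt {m : ℕ} (v : Fin m → Bool) : ℕ := ∑ i, if v i then 1 else 0

/-- `γ_w = a − Σ_i w_i c_i + |w|`. -/
noncomputable def gammaP {m : ℕ} (a : ℂ) (c : Fin m → ℂ) (w : Fin m → Bool) : ℂ :=
  a - ∑ i, (if w i then c i else 0) + (wt w : ℂ)

/-- `A_w = Σ ∏_{j=1}^r 1/γ_{w^{(j)}}`, the sum over all chains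
`w = w^{(r)} ≻ w^{(r−1)} ≻ ⋯ ≻ w^{(1)}` with `|w^{(j)}| = j` (here `r = |w|`;
a chain is encoded as `ch : Fin r → {0,1}^m` with `ch j = w^{(j+1)}`, the conditions
on weights making the inclusions automatically strict);
for `w = (0,…,0)` the empty chain gives `A_w = 1`. -/
noncomputable def Aw {m : ℕ} (γ : (Fin m → Bool) → ℂ) (w : Fin m → Bool) : ℂ :=
  ∑ ch ∈ (univ : Finset (Fin (wt w) → Fin m → Bool)).filter
      (fun ch =>
        (∀ j : Fin (wt w), wt (ch j) = j.val + 1) ∧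
        (∀ j : Fin (wt w), j.val = wt w - 1 → ch j = w) ∧
        (∀ j j' : Fin (wt w), j'.val = j.val + 1 →
          ∀ i, ch j i = true → ch j' i = true)),
    ∏ j, 1 / γ (ch j)

/-- The intersection matrix `C` with entries
`C_{v,v'} = Σ_w A_w · ∏_{i : w_i = 0} δ(v_i, v'_i)/β_{v_i,i}`. -/
noncomputable def Cmat {m : ℕ} (a : ℂ) (b c : Fin m → ℂ) :
    Matrix (Fin m → Bool) (Fin m → Bool) ℂ :=
  fun v v' => ∑ w, Aw (gammaP a c) w *
    ∏ i ∈ univ.filter (fun i => w i = false),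
      (if v i = v' i then 1 else 0) / betaP b c (v i) i

/-- `Σβ_v = Σ_i β_{v_i,i}`. -/
noncomputable def Sbeta {m : ℕ} (b c : Fin m → ℂ) (v : Fin m → Bool) : ℂ :=
  ∑ i, betaP b c (v i) i

/-- `Πβ_v = ∏_i β_{v_i,i}`. -/
noncomputable def Pbeta {m : ℕ} (b c : Fin m → ℂ) (v : Fin m → Bool) : ℂ :=
  ∏ i, betaP b c (v i) i

/-- The standard basis row vector `e_v` of `ℂ^{2^m}`, `(e_v)_w = δ_{v,w}`. -/
noncomputable def evec {m : ℕ} (v : Fin m → Bool) : (Fin m → Bool) → ℂ :=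
  fun w => if w = v then 1 else 0

/-- The coordinate row vector `f_v = ((a − Σβ_v)/a) e_v − Σ_j (β_{1−v_j,j}/a) e_{σ_j·v}`
of the class `ψ_v` in the frame `(φ_v)`. -/
noncomputable def fvec {m : ℕ} (a : ℂ) (b c : Fin m → ℂ) (v : Fin m → Bool) :
    (Fin m → Bool) → ℂ :=
  ((a - Sbeta b c v) / a) • evec v - ∑ j, (betaP b c (!(v j)) j / a) • evec (flipv j v)

/-- The residue matrix `R_k`: `(R_k)_{v,v} = −β_{v_k,k}`, `(R_k)_{v,σ_k·v} = −β_{1−v_k,k}`,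
all other entries `0`. -/
noncomputable def Rmat {m : ℕ} (b c : Fin m → ℂ) (k : Fin m) :
    Matrix (Fin m → Bool) (Fin m → Bool) ℂ :=
  fun v w =>
    if w = v then -betaP b c (v k) k
    else if w = flipv k v then -betaP b c (!(v k)) k
    else 0

/-- The residue matrix `N_v` along the hyperplane `1 − Σ v_i x_i = 0`:
`(N_v)_{u,w} = −a·Πβ_v·(C·f_vᵀ)_u·(f_v)_w`. -/
noncomputable def Nmat {m : ℕ} (a : ℂ) (b c : Fin m → ℂ) (v : Fin m → Bool) :
    Matrix (Fin m → Bool) (Fin m → Bool) ℂ :=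
  fun u w =>
    -a * Pbeta b c v * (∑ w', Cmat a b c u w' * fvec a b c v w') * fvec a b c v w

theorem flipv_ne_self {m : ℕ} (j : Fin m) (v : Fin m → Bool) : flipv j v ≠ v := by
  intro h
  have := congrFun h j
  simp [flipv] at this

theorem wt_update_false {m : ℕ} {w : Fin m → Bool} {j : Fin m} (hj : w j = true) :
    wt (Function.update w j false) + 1 = wt w := by
  unfold wt
  rw [← Finset.add_sum_erase univ _ (mem_univ j),
    ← Finset.add_sum_erase univ (fun i => if w i then 1 else 0) (mem_univ j)]
  have : ∑ i ∈ univ.erase j, (if Function.update w j false i then 1 else 0)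
      = ∑ i ∈ univ.erase j, (if w i then 1 else 0) :=
    Finset.sum_congr rfl fun i hi => by
      rw [Function.update_of_ne (Finset.ne_of_mem_erase hi)]
  rw [this]
  simp [hj, add_comm]

theorem eq_of_le_of_wt_eq {m : ℕ} {x w : Fin m → Bool} (h : ∀ i, x i = true → w i = true)
    (hwt : wt x = wt w) : x = w := by
  have hle : ∀ i ∈ (univ : Finset (Fin m)), (if x i then 1 else 0) ≤ (if w i then 1 else 0) := by
    intro i _
    have := h i
    cases hx : x i <;> cases hw : w i <;> simp_all
  have := (Finset.sum_eq_sum_iff_of_le hle).1 hwt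
  funext i
  have := this i (mem_univ i)
  cases hx : x i <;> cases hw : w i <;> simp_all

theorem exists_eq_update_false_of_le {m : ℕ} {x w : Fin m → Bool}
    (h : ∀ i, x i = true → w i = true) (hwt : wt x + 1 = wt w) :
    ∃ j, w j = true ∧ x = Function.update w j false := by
  obtain ⟨j, hwj, hxj⟩ : ∃ j, w j = true ∧ x j = false := by
    by_contra! hcon
    have : x = w := by
      funext i
      have h1 := h i
      have h2 := hcon i
      cases hx : x i <;> cases hw : w i <;> simp_all
    subst this
    omega
  refine ⟨j, hwj, eq_of_le_of_wt_eq (fun i hi => ?_) ?_⟩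
  · rcases eq_or_ne i j with rfl | hij
    · simp_all
    · rw [Function.update_of_ne hij]
      exact h i hi
  · have := wt_update_false hwj
    omega

theorem wt_eq_zero_iff {m : ℕ} {w : Fin m → Bool} : wt w = 0 ↔ w = fun _ => false := by
  simp [wt, funext_iff]

/-- The chains `w = ch (n - 1) ≻ ⋯ ≻ ch 0` with `|ch j| = j + 1`. -/
def IsChainTo {m n : ℕ} (w : Fin m → Bool) (ch : Fin n → Fin m → Bool) : Prop :=
  (∀ j : Fin n, wt (ch j) = j.val + 1) ∧
  (∀ j : Fin n, j.val = n - 1 → ch j = w) ∧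
  (∀ j j' : Fin n, j'.val = j.val + 1 → ∀ i, ch j i = true → ch j' i = true)

/-- The sum of `∏ 1 / γ` over the chains of length `n` ending in `w`. -/
noncomputable def chainSum {m : ℕ} (γ : (Fin m → Bool) → ℂ) (n : ℕ) (w : Fin m → Bool) : ℂ :=
  ∑ ch ∈ (univ : Finset (Fin n → Fin m → Bool)).filter (IsChainTo w), ∏ j, 1 / γ (ch j)

theorem Aw_eq_chainSum {m : ℕ} (γ : (Fin m → Bool) → ℂ) (w : Fin m → Bool) :
    Aw γ w = chainSum γ (wt w) w := by
  unfold Aw chainSum IsChainTo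
  congr!

theorem isChainTo_snoc_iff {m n : ℕ} {w : Fin m → Bool} (hw : wt w = n + 1)
    (ch : Fin n → Fin m → Bool) :
    IsChainTo w (Fin.snoc ch w : Fin (n + 1) → Fin m → Bool) ↔
      ∃ j, w j = true ∧ IsChainTo (Function.update w j false) ch := by
  constructor
  · rintro ⟨h1, -, h3⟩
    have h1' : ∀ j : Fin n, wt (ch j) = j.val + 1 := fun j => by simpa using h1 j.castSucc
    have h3' : ∀ j j' : Fin n, j'.val = j.val + 1 → ∀ i, ch j i = true → ch j' i = true :=
      fun j j' hjj' => by simpa using h3 j.castSucc j'.castSucc (by simpa using hjj')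
    rcases n with _ | n
    · have : ∃ j, w j = true := by
        by_contra! hcon
        have : w = fun _ => false := funext fun i => by simpa using hcon i
        rw [wt_eq_zero_iff.2 this] at hw
        omega
      obtain ⟨j, hj⟩ := this
      exact ⟨j, hj, fun j => j.elim0, fun j => j.elim0, fun j => j.elim0⟩
    · have hle : ∀ i, ch (Fin.last n) i = true → w i = true := by
        simpa using h3 (Fin.last n).castSucc (Fin.last (n + 1)) (by simp)
      have hwt : wt (ch (Fin.last n)) + 1 = wt w := by rw [h1', hw]; simp
      obtain ⟨j, hj, hx⟩ := exists_eq_update_false_of_le hle hwt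
      refine ⟨j, hj, h1', fun k hk => ?_, h3'⟩
      have : k = Fin.last n := Fin.ext (by simpa using hk)
      rw [this, hx]
  · rintro ⟨j, hj, h1, h2, h3⟩
    refine ⟨fun k => ?_, fun k hk => ?_, fun k k' hkk' i hi => ?_⟩
    · induction k using Fin.lastCases with
      | last => simpa using hw
      | cast k => simpa using h1 k
    · have : k = Fin.last n := Fin.ext (by simpa using hk)
      simp [this]
    · induction k using Fin.lastCases with
      | last =>
        have := k'.isLt
        simp at hkk'
        omega
      | cast k =>
        induction k' using Fin.lastCases with
        | last =>
          have hk := h2 k (by simp at hkk'; omega)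
          simp only [Fin.snoc_castSucc, Fin.snoc_last, hk] at hi ⊢
          rcases eq_or_ne i j with rfl | hij
          · exact hj
          · rwa [Function.update_of_ne hij] at hi
        | cast k' =>
          simp only [Fin.snoc_castSucc] at hi ⊢
          exact h3 k k' (by simpa using hkk') i hi

theorem eq_of_isChainTo_update_false {m n : ℕ} {w : Fin m → Bool} (hw : wt w = n + 1)
    {ch : Fin n → Fin m → Bool} {j k : Fin m} (hj : w j = true) (hk : w k = true)
    (hcj : IsChainTo (Function.update w j false) ch)
    (hck : IsChainTo (Function.update w k false) ch) : j = k := by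
  have key : Function.update w j false = Function.update w k false := by
    rcases n with _ | n
    · have h1 := wt_update_false hj
      have h2 := wt_update_false hk
      rw [wt_eq_zero_iff.1 (by omega : wt (Function.update w j false) = 0),
        wt_eq_zero_iff.1 (by omega : wt (Function.update w k false) = 0)]
    · rw [← hcj.2.1 (Fin.last n) (by simp), ← hck.2.1 (Fin.last n) (by simp)]
  by_contra hne
  have := congrFun key j
  rw [Function.update_self, Function.update_of_ne hne, hj] at this
  exact Bool.false_ne_true this

theorem chainSum_succ {m n : ℕ} (γ : (Fin m → Bool) → ℂ) {w : Fin m → Bool}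
    (hw : wt w = n + 1) :
    chainSum γ (n + 1) w =
      1 / γ w * ∑ j ∈ univ.filter (fun j => w j = true),
        chainSum γ n (Function.update w j false) := by
  unfold chainSum
  rw [← Finset.sum_biUnion, Finset.mul_sum]
  · refine Finset.sum_nbij' (fun ch => Fin.init ch) (fun ch => Fin.snoc ch w) ?_ ?_ ?_ ?_ ?_
    · intro ch hch
      have hch : IsChainTo w ch := by simpa using hch
      have hl : ch (Fin.last n) = w := hch.2.1 _ (by simp)
      rw [← Fin.snoc_init_self ch, hl, isChainTo_snoc_iff hw] at hch
      simpa using hch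
    · intro ch hch
      simp only [mem_biUnion, mem_filter, mem_univ, true_and] at hch ⊢
      exact (isChainTo_snoc_iff hw ch).2 hch
    · intro ch hch
      have hch : IsChainTo w ch := by simpa using hch
      have hl : ch (Fin.last n) = w := hch.2.1 _ (by simp)
      rw [← hl]
      exact Fin.snoc_init_self ch
    · intro ch _
      exact Fin.init_snoc _ _
    · intro ch hch
      have hch : IsChainTo w ch := by simpa using hch
      have hl : ch (Fin.last n) = w := hch.2.1 _ (by simp)
      rw [Fin.prod_univ_castSucc, hl, mul_comm]
      rfl
  · intro j hj k hk hne
    rw [Function.onFun, Finset.disjoint_left]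
    intro ch hcj hck
    simp only [coe_filter, Set.mem_ofPred_eq, mem_filter, mem_univ, true_and] at hj hk hcj hck
    exact hne (eq_of_isChainTo_update_false hw hj hk hcj hck)

theorem Aw_zero {m : ℕ} (γ : (Fin m → Bool) → ℂ) : Aw γ (fun _ => false) = 1 := by
  rw [Aw_eq_chainSum, wt_eq_zero_iff.2 rfl]
  rw [chainSum, Finset.filter_true_of_mem fun ch _ =>
    ⟨fun j => j.elim0, fun j => j.elim0, fun j => j.elim0⟩]
  simp

theorem mul_Aw {m : ℕ} {γ : (Fin m → Bool) → ℂ} {w : Fin m → Bool} (hγ : γ w ≠ 0)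
    (hw : w ≠ fun _ => false) :
    γ w * Aw γ w =
      ∑ j ∈ univ.filter (fun j => w j = true), Aw γ (Function.update w j false) := by
  obtain ⟨n, hn⟩ := Nat.exists_eq_succ_of_ne_zero (mt wt_eq_zero_iff.1 hw)
  rw [Aw_eq_chainSum, hn, Nat.succ_eq_add_one, chainSum_succ γ hn, ← mul_assoc,
    mul_one_div_cancel hγ, one_mul]
  refine Finset.sum_congr rfl fun j hj => ?_
  have := wt_update_false (mem_filter.1 hj).2
  rw [Aw_eq_chainSum, show wt (Function.update w j false) = n by omega]

/-- The product `∏_{i : w_i = 0} δ(u_i, v_i)/β_{u_i,i}` attached to `w` in the entries of `C`. -/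
noncomputable def deltaProd {m : ℕ} (b c : Fin m → ℂ) (w u v : Fin m → Bool) : ℂ :=
  ∏ i ∈ univ.filter (fun i => w i = false), (if u i = v i then 1 else 0) / betaP b c (u i) i

theorem deltaProd_eq_mul_update {m : ℕ} (b c : Fin m → ℂ) {w : Fin m → Bool} (u v : Fin m → Bool)
    {j : Fin m} (hj : w j = false) :
    deltaProd b c w u v = (if u j = v j then 1 else 0) / betaP b c (u j) j *
      deltaProd b c (Function.update w j true) u v := by
  unfold deltaProd
  rw [← Finset.mul_prod_erase (univ.filter fun i => w i = false) _ (by simpa using hj)]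
  congr 2
  ext i
  rcases eq_or_ne i j with rfl | hij <;> simp [*]

theorem deltaProd_flipv {m : ℕ} (b c : Fin m → ℂ) {w : Fin m → Bool} (u v : Fin m → Bool)
    {j : Fin m} (hj : w j = true) : deltaProd b c w u (flipv j v) = deltaProd b c w u v := by
  refine Finset.prod_congr rfl fun i hi => ?_
  have hij : i ≠ j := by
    rintro rfl
    simp_all
  rw [flipv, Function.update_of_ne hij]

theorem betaP_mul_deltaProd_add {m : ℕ} {b c : Fin m → ℂ} (hβ : ∀ s i, betaP b c s i ≠ 0)
    (w u v : Fin m → Bool) (j : Fin m) :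
    betaP b c (v j) j * deltaProd b c w u v +
        betaP b c (!(v j)) j * deltaProd b c w u (flipv j v) =
      if w j = true then (c j - 1) * deltaProd b c w u v
      else deltaProd b c (Function.update w j true) u v := by
  split_ifs with hj
  · rw [deltaProd_flipv b c u v hj]
    cases v j <;> simp [betaP] <;> ring
  · rw [Bool.not_eq_true] at hj
    rw [deltaProd_eq_mul_update b c u v hj, deltaProd_eq_mul_update b c u (flipv j v) hj,
      deltaProd_flipv b c u v (by simp : Function.update w j true j = true)]
    have h0 := hβ false j
    have h1 := hβ true j
    cases hv : v j <;> cases hu : u j <;> simp [flipv, hv, h0, h1]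

theorem sum_mul_fvec {m : ℕ} (a : ℂ) (b c : Fin m → ℂ) (v : Fin m → Bool)
    (g : (Fin m → Bool) → ℂ) :
    ∑ w, g w * fvec a b c v w =
      ((a - Sbeta b c v) * g v - ∑ j, betaP b c (!(v j)) j * g (flipv j v)) / a := by
  have he : ∀ x, ∑ w, g w * evec x w = g x := fun x => by simp [evec]
  simp only [fvec, Pi.sub_apply, Pi.smul_apply, Finset.sum_apply, smul_eq_mul,
    mul_sub (g _), Finset.mul_sum, Finset.sum_sub_distrib]
  rw [sub_div ((a - Sbeta b c v) * g v), Finset.sum_div]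
  congr 1
  · rw [← he v, Finset.mul_sum, Finset.sum_div]
    exact Finset.sum_congr rfl fun w _ => by ring
  · rw [Finset.sum_comm]
    refine Finset.sum_congr rfl fun j _ => ?_
    rw [← he (flipv j v), Finset.mul_sum, Finset.sum_div]
    exact Finset.sum_congr rfl fun w _ => by ring

theorem gammaP_eq {m : ℕ} (a : ℂ) (c : Fin m → ℂ) (w : Fin m → Bool) :
    gammaP a c w = a - ∑ j, if w j = true then c j - 1 else 0 := by
  have : ∑ j, (if w j = true then c j - 1 else 0) =
      ∑ j, (if w j = true then c j else 0) - (wt w : ℂ) := by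
    rw [wt, Nat.cast_sum, ← Finset.sum_sub_distrib]
    exact Finset.sum_congr rfl fun j _ => by split_ifs <;> simp
  rw [gammaP, this]
  ring

theorem deltaProd_combination {m : ℕ} {a : ℂ} {b c : Fin m → ℂ}
    (hβ : ∀ s i, betaP b c s i ≠ 0) (w u v : Fin m → Bool) :
    (a - Sbeta b c v) * deltaProd b c w u v -
        ∑ j, betaP b c (!(v j)) j * deltaProd b c w u (flipv j v) =
      gammaP a c w * deltaProd b c w u v -
        ∑ j, if w j = false then deltaProd b c (Function.update w j true) u v else 0 := by
  have h := Finset.sum_congr (s₁ := univ) rfl fun j _ => betaP_mul_deltaProd_add hβ w u v j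
  have h' : ∑ j, (if w j = true then (c j - 1) * deltaProd b c w u v
      else deltaProd b c (Function.update w j true) u v) =
      (∑ j, if w j = true then c j - 1 else 0) * deltaProd b c w u v +
        ∑ j, if w j = false then deltaProd b c (Function.update w j true) u v else 0 := by
    rw [Finset.sum_mul, ← Finset.sum_add_distrib]
    exact Finset.sum_congr rfl fun j _ => by cases w j <;> simp
  rw [h', Finset.sum_add_distrib, ← Finset.sum_mul] at h
  rw [gammaP_eq, Sbeta]
  linear_combination -h

theorem sum_update_true_eq {m : ℕ} (A P : (Fin m → Bool) → ℂ) :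
    ∑ w, A w * (∑ j, if w j = false then P (Function.update w j true) else 0) =
      ∑ w, (∑ j ∈ univ.filter (fun j => w j = true), A (Function.update w j false)) * P w := by
  simp only [Finset.mul_sum, Finset.sum_mul, Finset.sum_filter, mul_ite, mul_zero,
    ite_mul, zero_mul]
  rw [Finset.sum_comm]
  conv_rhs => rw [Finset.sum_comm]
  refine Finset.sum_congr rfl fun j _ => ?_
  rw [← Finset.sum_filter, ← Finset.sum_filter]
  refine Finset.sum_nbij' (fun w => Function.update w j true) (fun w => Function.update w j false)
    ?_ ?_ ?_ ?_ ?_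
  · simp
  · simp
  · intro w hw
    simp only [mem_filter, mem_univ, true_and] at hw
    simp [← hw]
  · intro w hw
    simp only [mem_filter, mem_univ, true_and] at hw
    simp [← hw]
  · intro w hw
    simp only [mem_filter, mem_univ, true_and] at hw
    simp [← hw]

/-- `C · f_vᵀ = (Πβ_v)⁻¹ e_vᵀ`. -/
theorem Cmat_mul_fvec {m : ℕ} {a : ℂ} {b c : Fin m → ℂ} (ha : a ≠ 0)
    (hβ : ∀ s i, betaP b c s i ≠ 0) (hγ : ∀ w : Fin m → Bool, gammaP a c w ≠ 0)
    (u v : Fin m → Bool) :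
    ∑ w', Cmat a b c u w' * fvec a b c v w' = if u = v then (Pbeta b c v)⁻¹ else 0 := by
  have hC : ∀ x, Cmat a b c u x = ∑ w, Aw (gammaP a c) w * deltaProd b c w u x := fun _ => rfl
  have hsum : (a - Sbeta b c v) * Cmat a b c u v -
      ∑ j, betaP b c (!(v j)) j * Cmat a b c u (flipv j v) =
      ∑ w, (gammaP a c w * Aw (gammaP a c) w -
        ∑ j ∈ univ.filter (fun j => w j = true), Aw (gammaP a c) (Function.update w j false)) *
          deltaProd b c w u v := by
    simp only [sub_mul (_ * _), Finset.sum_sub_distrib]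
    rw [← sum_update_true_eq (Aw (gammaP a c)) (fun w => deltaProd b c w u v)]
    have hS : ∑ j, betaP b c (!(v j)) j * Cmat a b c u (flipv j v) =
        ∑ w, ∑ j, betaP b c (!(v j)) j *
          (Aw (gammaP a c) w * deltaProd b c w u (flipv j v)) := by
      simp only [hC, Finset.mul_sum]
      exact Finset.sum_comm
    rw [hS, hC, Finset.mul_sum, ← Finset.sum_sub_distrib, ← Finset.sum_sub_distrib]
    refine Finset.sum_congr rfl fun w _ => ?_
    have h := deltaProd_combination (a := a) hβ w u v
    have h2 : ∑ j, betaP b c (!(v j)) j *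
        (Aw (gammaP a c) w * deltaProd b c w u (flipv j v)) =
        Aw (gammaP a c) w * ∑ j, betaP b c (!(v j)) j * deltaProd b c w u (flipv j v) := by
      rw [Finset.mul_sum]
      exact Finset.sum_congr rfl fun j _ => by ring
    rw [h2]
    linear_combination Aw (gammaP a c) w * h
  rw [sum_mul_fvec a b c v (fun x => Cmat a b c u x), hsum,
    Finset.sum_eq_single (fun _ => false)]
  · have hg : gammaP a c (fun _ => false) = a := by simp [gammaP_eq]
    rw [Aw_zero, hg]
    simp only [Bool.false_eq_true, Finset.filter_false, Finset.sum_empty, mul_one, sub_zero]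
    rw [mul_div_cancel_left₀ _ ha]
    split_ifs with huv
    · simp [deltaProd, huv, Pbeta]
    · obtain ⟨i, hi⟩ := Function.ne_iff.1 huv
      exact Finset.prod_eq_zero (i := i) (by simp) (by simp [hi])
  · intro w _ hw
    rw [mul_Aw (hγ w) hw, sub_self, zero_mul]
  · simp

theorem vecMul_Nmat {m : ℕ} {a : ℂ} {b c : Fin m → ℂ} (ha : a ≠ 0)
    (hβ : ∀ s i, betaP b c s i ≠ 0) (hγ : ∀ w : Fin m → Bool, gammaP a c w ≠ 0)
    (v : Fin m → Bool) (z : (Fin m → Bool) → ℂ) :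
    Matrix.vecMul z (Nmat a b c v) = (-a * z v) • fvec a b c v := by
  have hP : Pbeta b c v ≠ 0 := Finset.prod_ne_zero_iff.2 fun i _ => hβ _ _
  funext w
  simp only [Matrix.vecMul, dotProduct, Nmat, Cmat_mul_fvec ha hβ hγ, Pi.smul_apply, smul_eq_mul]
  rw [Finset.sum_eq_single v]
  · simp only [if_true]
    field_simp
  · intro u _ hu
    simp [hu]
  · simp

theorem fvec_self {m : ℕ} (a : ℂ) (b c : Fin m → ℂ) (v : Fin m → Bool) :
    fvec a b c v v = (a - Sbeta b c v) / a := by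
  simp [fvec, evec, (flipv_ne_self _ v).symm]

theorem span_evec_ne {m : ℕ} (v : Fin m → Bool) :
    (Submodule.span ℂ {z | ∃ w : Fin m → Bool, w ≠ v ∧ z = evec w} : Set ((Fin m → Bool) → ℂ)) =
      {z | z v = 0} := by
  refine Set.Subset.antisymm ?_ fun z (hz : z v = 0) => ?_
  · have : Submodule.span ℂ {z | ∃ w : Fin m → Bool, w ≠ v ∧ z = evec w} ≤
        LinearMap.ker (LinearMap.proj (R := ℂ) (φ := fun _ : Fin m → Bool => ℂ) v) := by
      rw [Submodule.span_le]
      rintro _ ⟨w, hw, rfl⟩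
      simp [evec, hw.symm]
    exact fun z hz => this hz
  · have : z = ∑ w, z w • evec w := by
      funext x
      simp [evec]
    rw [this]
    refine Submodule.sum_mem _ fun w _ => ?_
    rcases eq_or_ne w v with rfl | hw
    · simp [hz]
    · exact Submodule.smul_mem _ _ (Submodule.subset_span ⟨w, hw, rfl⟩)

/-- **Lemma 4.6(ii) / Lemma 4.8(ii).** With `N_v` acting on row vectors by `z ↦ z·N_v`:
(1) `f_v·N_v = (Σβ_v − a)·f_v`; (2) `e_w·N_v = 0` for `w ≠ v`; (3) if `Σβ_v ≠ a`, the
kernel is the span of `{e_w : w ≠ v}` and has dimension `2^m − 1`, the eigenspace of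
`Σβ_v − a` is spanned by `f_v`, and `0` and `Σβ_v − a` are the only eigenvalues. -/
theorem stmt_12 (m : ℕ) (hm : 1 ≤ m) (a : ℂ) (b c : Fin m → ℂ) (ha : a ≠ 0)
    (hb0 : ∀ i, betaP b c false i ≠ 0) (hb1 : ∀ i, betaP b c true i ≠ 0)
    (hγ : ∀ w : Fin m → Bool, gammaP a c w ≠ 0) (v : Fin m → Bool) :
    Matrix.vecMul (fvec a b c v) (Nmat a b c v) = (Sbeta b c v - a) • fvec a b c v ∧
    (∀ w : Fin m → Bool, w ≠ v → Matrix.vecMul (evec w) (Nmat a b c v) = 0) ∧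
    (Sbeta b c v ≠ a →
      LinearMap.ker (Nmat a b c v).vecMulLinear =
        Submodule.span ℂ {z | ∃ w : Fin m → Bool, w ≠ v ∧ z = evec w} ∧
      Module.finrank ℂ (LinearMap.ker (Nmat a b c v).vecMulLinear) = 2 ^ m - 1 ∧
      Module.End.eigenspace (Nmat a b c v).vecMulLinear (Sbeta b c v - a) =
        Submodule.span ℂ {fvec a b c v} ∧
      Module.End.HasEigenvalue (Nmat a b c v).vecMulLinear 0 ∧
      Module.End.HasEigenvalue (Nmat a b c v).vecMulLinear (Sbeta b c v - a) ∧
      ∀ μ : ℂ, Module.End.HasEigenvalue (Nmat a b c v).vecMulLinear μ →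
        μ = 0 ∨ μ = Sbeta b c v - a) := by
  have hβ : ∀ s i, betaP b c s i ≠ 0 := fun s i => by cases s <;> simp [hb0, hb1]
  have hN := vecMul_Nmat ha hβ hγ v
  have hfN : Matrix.vecMul (fvec a b c v) (Nmat a b c v) =
      (Sbeta b c v - a) • fvec a b c v := by
    rw [hN, fvec_self]
    congr 1
    field_simp
    ring
  have heN : ∀ w : Fin m → Bool, w ≠ v → Matrix.vecMul (evec w) (Nmat a b c v) = 0 := by
    intro w hw
    simp [hN, evec, hw.symm]
  refine ⟨hfN, heN, fun hS => ?_⟩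
  have hS' : Sbeta b c v - a ≠ 0 := sub_ne_zero.2 hS
  have hfv : fvec a b c v v ≠ 0 := by
    rw [fvec_self]
    exact div_ne_zero (sub_ne_zero.2 hS.symm) ha
  have hf : fvec a b c v ≠ 0 := fun h => hfv (by simp [h])
  have hker : ∀ z, z ∈ LinearMap.ker (Nmat a b c v).vecMulLinear ↔ z v = 0 := by
    intro z
    simp [hN, ha, hf]
  have hrange : LinearMap.range (Nmat a b c v).vecMulLinear =
      Submodule.span ℂ {fvec a b c v} := by
    refine le_antisymm ?_ ?_
    · rintro _ ⟨z, rfl⟩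
      rw [Matrix.vecMulLinear_apply, hN]
      exact Submodule.smul_mem _ _ (Submodule.mem_span_singleton_self _)
    · rw [Submodule.span_singleton_le_iff_mem]
      refine ⟨(Sbeta b c v - a)⁻¹ • fvec a b c v, ?_⟩
      rw [map_smul, Matrix.vecMulLinear_apply, hfN, inv_smul_smul₀ hS']
  refine ⟨?_, ?_, ?_, ?_, ?_, ?_⟩
  · refine SetLike.coe_injective ?_
    rw [span_evec_ne]
    ext z
    exact hker z
  · have h := LinearMap.finrank_range_add_finrank_ker (Nmat a b c v).vecMulLinear
    rw [hrange, finrank_span_singleton hf, Module.finrank_fintype_fun_eq_card] at h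
    simp only [Fintype.card_pi, Fintype.card_bool, Finset.prod_const, Finset.card_univ,
      Fintype.card_fin] at h
    omega
  · refine le_antisymm (fun z hz => ?_) ?_
    · rw [Module.End.mem_eigenspace_iff, Matrix.vecMulLinear_apply, hN] at hz
      refine Submodule.mem_span_singleton.2 ⟨(Sbeta b c v - a)⁻¹ * (-a * z v), ?_⟩
      rw [mul_smul, hz, inv_smul_smul₀ hS']
    · rw [Submodule.span_singleton_le_iff_mem, Module.End.mem_eigenspace_iff]
      exact hfN
  · refine Module.End.hasEigenvalue_of_hasEigenvector (x := evec (flipv ⟨0, hm⟩ v)) ?_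
    rw [Module.End.hasEigenvector_iff, Module.End.mem_eigenspace_iff]
    refine ⟨?_, fun h => ?_⟩
    · rw [zero_smul]
      exact heN _ (flipv_ne_self _ v)
    · simpa [evec] using congrFun h (flipv ⟨0, hm⟩ v)
  · refine Module.End.hasEigenvalue_of_hasEigenvector (x := fvec a b c v) ?_
    rw [Module.End.hasEigenvector_iff, Module.End.mem_eigenspace_iff]
    exact ⟨hfN, hf⟩
  · intro μ hμ
    obtain ⟨z, hz⟩ := hμ.exists_hasEigenvector
    rw [Module.End.hasEigenvector_iff, Module.End.mem_eigenspace_iff,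
      Matrix.vecMulLinear_apply, hN] at hz
    obtain ⟨hz, hz0⟩ := hz
    by_cases hzv : z v = 0
    · left
      simpa [hzv, hz0, eq_comm] using hz
    · right
      have h := congrFun hz v
      simp only [Pi.smul_apply, smul_eq_mul, fvec_self] at h
      field_simp at h
      linear_combination -h
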